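/- Let f(x) = (1 − x)^α (1 + x)^β g(x) with α, β > −1/2 not both integers and g infinitely differentiable on [−1,1], and let a_n denote its Chebyshev coefficients. If neither α nor β is a nonnegative integer, then as n → ∞: (i) if α > β, a_n = (−1)^{n+1} 2^{α−β+1} g(−1) sin(βπ) Γ(2β+1)/(π n^{2β+1}) + O(n^{−min{2α+1, 2β+3}}); (ii) if α = β, a_n = −(2 sin(απ) Γ(2α+1)/(π n^{2α+1}))(g(1) + (−1)^n g(−1)) + O(n^{−2α−3}); (iii) if α < β, a_n = −2^{β−α+1} g(1) sin(απ) Γ(2α+1)/(π n^{2α+1}) + O(n^{−min{2α+3, 2β+1}}). Furthermore, if α is a nonnegative integer (and β is not), then a_n = (−1)^{n+1} 2^{α−β+1} g(−1) sin(βπ) Γ(2β+1)/(π n^{2β+1}) + O(n^{−2β−3}); and if β is a nonnegative integer (and α is not), then a_n = −2^{β−α+1} g(1) sin(απ) Γ(2α+1)/(π n^{2α+1}) + O(n^{−2α−3}). -/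

import Mathlib

open Real Filter Finset

/-- The Chebyshev coefficients of `f : [-1,1] → ℝ`:
`a_k = (2/π) ∫_0^π f(cos t) cos(kt) dt`. -/
noncomputable def chebCoeff (f : ℝ → ℝ) (k : ℕ) : ℝ :=
  (2 / π) * ∫ t in (0 : ℝ)..π, f (Real.cos t) * Real.cos ((k : ℝ) * t)

section Helpers

open MeasureTheory Topology
open scoped ContDiff

/-- Near the origin, `t ^ a * η t` is integrable if `η` vanishes there or `-1 < a`. -/
theorem integrableOn_Ioc_rpow_mul {a R : ℝ} {η : ℝ → ℝ} (hη : Continuous η)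
    (h0 : (∃ δ > 0, ∀ t < δ, η t = 0) ∨ -1 < a) :
    IntegrableOn (fun t => t ^ a * η t) (Set.Ioc 0 R) := by
  rcases h0 with ⟨δ, hδ, h⟩ | h
  · have hc : Continuous fun t : ℝ => t ^ a * η t := by
      rw [continuous_iff_continuousAt]
      intro t
      rcases lt_or_ge t δ with ht | ht
      · have : (fun t : ℝ => t ^ a * η t) =ᶠ[𝓝 t] fun _ => 0 := by
          filter_upwards [Iio_mem_nhds ht] with s hs
          simp [h s hs]
        exact continuousAt_const.congr this.symm
      · exact (continuousAt_rpow_const t a (Or.inl (hδ.trans_le ht).ne')).mul hη.continuousAt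
    exact (hc.continuousOn.integrableOn_Icc).mono_set Set.Ioc_subset_Icc_self
  · have h1 : IntegrableOn (fun t : ℝ => t ^ a) (Set.Ioc 0 R) :=
      (intervalIntegral.intervalIntegrable_rpow' (a := 0) (b := R) h).1
    exact h1.mul_continuousOn_of_subset hη.continuousOn measurableSet_Ioc isCompact_Icc
      Set.Ioc_subset_Icc_self

theorem exists_bound_of_eventually_const {η : ℝ → ℝ} (hη : Continuous η)
    (hR : ∃ R c : ℝ, ∀ t > R, η t = c) : ∃ C, ∀ t > 0, |η t| ≤ C := by
  obtain ⟨R, c, h⟩ := hR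
  obtain ⟨C, hC⟩ := (isCompact_Icc (a := (0 : ℝ)) (b := R)).exists_bound_of_continuousOn
    hη.continuousOn
  refine ⟨max C |c|, fun t ht => ?_⟩
  rcases lt_or_ge R t with h1 | h1
  · rw [h t h1]; exact le_max_right _ _
  · exact (hC t ⟨ht.le, h1⟩).trans (le_max_left _ _)

theorem continuousOn_Ici_rpow_mul {a : ℝ} {η : ℝ → ℝ} (hη : Continuous η) :
    ContinuousOn (fun t : ℝ => t ^ a * η t) (Set.Ici 1) := by
  refine ContinuousOn.mul (fun t ht => ?_) hη.continuousOn
  exact (continuousAt_rpow_const t a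
    (Or.inl (zero_lt_one.trans_le ht).ne')).continuousWithinAt

theorem integrableOn_Ioi_rpow_mul {a : ℝ} {η : ℝ → ℝ} (hη : Continuous η)
    (h0 : (∃ δ > 0, ∀ t < δ, η t = 0) ∨ -1 < a)
    (hR : ∃ R c : ℝ, ∀ t > R, η t = c) (h1 : (∃ R : ℝ, ∀ t > R, η t = 0) ∨ a < -1) :
    IntegrableOn (fun t => t ^ a * η t) (Set.Ioi 0) := by
  rw [← Set.Ioc_union_Ioi_eq_Ioi zero_le_one]
  refine (integrableOn_Ioc_rpow_mul hη h0).union ?_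
  rcases h1 with ⟨R, h⟩ | h
  · rw [← Set.Ioc_union_Ioi_eq_Ioi (le_max_left 1 R)]
    refine IntegrableOn.union ?_ ?_
    · exact (((continuousOn_Ici_rpow_mul hη).mono
        Set.Icc_subset_Ici_self).integrableOn_Icc).mono_set Set.Ioc_subset_Icc_self
    · refine (integrableOn_zero (s := Set.Ioi (max 1 R))).congr_fun (fun t ht => ?_)
        measurableSet_Ioi
      simp [h t ((le_max_right 1 R).trans_lt ht)]
  · obtain ⟨C, hC⟩ := exists_bound_of_eventually_const hη hR
    refine Integrable.mul_bdd (c := C) (integrableOn_Ioi_rpow_of_lt h zero_lt_one)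
      hη.aestronglyMeasurable ?_
    filter_upwards [ae_restrict_mem measurableSet_Ioi] with t ht
    exact hC t (zero_lt_one.trans ht)

/-- The integrand of the Laplace transform of `t ^ a * η t`. -/
noncomputable def laplaceIntegrand (a : ℝ) (η : ℝ → ℝ) (z : ℂ) (t : ℝ) : ℂ :=
  ((t ^ a * η t : ℝ) : ℂ) * Complex.exp (-z * t)

theorem norm_laplaceIntegrand (a : ℝ) (η : ℝ → ℝ) (z : ℂ) (t : ℝ) :
    ‖laplaceIntegrand a η z t‖ = |t ^ a * η t| * Real.exp (-z.re * t) := by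
  rw [laplaceIntegrand, norm_mul, Complex.norm_real, Complex.norm_exp]
  simp

theorem continuousOn_laplaceIntegrand {a : ℝ} {η : ℝ → ℝ} (hη : Continuous η) (z : ℂ) :
    ContinuousOn (laplaceIntegrand a η z) (Set.Ioi 0) := by
  unfold laplaceIntegrand
  refine ContinuousOn.mul (Complex.continuous_ofReal.comp_continuousOn ?_) (by fun_prop)
  refine ContinuousOn.mul (fun t ht => ?_) hη.continuousOn
  exact (continuousAt_rpow_const t a (Or.inl (ne_of_gt ht))).continuousWithinAt

theorem integrableOn_laplaceIntegrand {a : ℝ} {η : ℝ → ℝ} (hη : Continuous η)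
    (h0 : (∃ δ > 0, ∀ t < δ, η t = 0) ∨ -1 < a)
    (hR : ∃ R c : ℝ, ∀ t > R, η t = c) {z : ℂ} (hz : 0 < z.re) :
    IntegrableOn (laplaceIntegrand a η z) (Set.Ioi 0) := by
  obtain ⟨C, hC⟩ := exists_bound_of_eventually_const hη hR
  have key : IntegrableOn (fun t : ℝ => t ^ a * η t * Real.exp (-z.re * t)) (Set.Ioi 0) := by
    rw [← Set.Ioc_union_Ioi_eq_Ioi zero_le_one]
    refine IntegrableOn.union ?_ ?_
    · exact (integrableOn_Ioc_rpow_mul hη h0).mul_continuousOn_of_subset (by fun_prop)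
        measurableSet_Ioc isCompact_Icc Set.Ioc_subset_Icc_self
    · refine integrable_of_isBigO_exp_neg (b := z.re / 2) (by linarith)
        ((continuousOn_Ici_rpow_mul hη).mul (by fun_prop)) ?_
      have h1 := (isLittleO_rpow_exp_pos_mul_atTop a (half_pos hz)).isBigO
      have h2 : η =O[atTop] fun _ => (1 : ℝ) := by
        refine Asymptotics.IsBigO.of_bound C ?_
        filter_upwards [eventually_gt_atTop 0] with t ht
        simpa using hC t ht
      refine ((h1.mul h2).mul (Asymptotics.isBigO_refl (fun t : ℝ => Real.exp (-z.re * t)) _)).trans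
        (Asymptotics.isBigO_of_le _ fun t => ?_)
      rw [mul_one, ← Real.exp_add]
      apply le_of_eq
      congr 2
      ring
  refine key.norm.mono' ((continuousOn_laplaceIntegrand hη z).aestronglyMeasurable
    measurableSet_Ioi) ?_
  refine Eventually.of_forall fun t => ?_
  rw [norm_laplaceIntegrand, norm_mul]
  simp

theorem hasDerivAt_laplaceIntegrand {a : ℝ} {η : ℝ → ℝ} (hη : ContDiff ℝ ∞ η) (z : ℂ) {t : ℝ}
    (ht : 0 < t) :
    HasDerivAt (laplaceIntegrand a η z)
      (laplaceIntegrand (a - 1) (fun t => a * η t + t * deriv η t) z t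
        - z * laplaceIntegrand a η z t) t := by
  have h1 : HasDerivAt (fun t : ℝ => t ^ a * η t)
      (t ^ (a - 1) * (a * η t + t * deriv η t)) t := by
    have := (Real.hasDerivAt_rpow_const (x := t) (p := a) (Or.inl ht.ne')).mul
      ((hη.differentiable (by simp)) t).hasDerivAt
    refine this.congr_deriv ?_
    have h : t ^ a = t ^ (a - 1) * t := by
      rw [Real.rpow_sub_one ht.ne']; field_simp
    rw [h]; ring
  have h2 : HasDerivAt (fun t : ℝ => Complex.exp (-z * t)) (Complex.exp (-z * t) * (-z * 1)) t :=
    ((Complex.ofRealCLM.hasDerivAt (x := t)).const_mul (-z)).cexp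
  refine (h1.ofReal_comp.mul h2).congr_deriv ?_
  simp only [laplaceIntegrand]
  ring

theorem euler_step_eq_of_isOpen {η : ℝ → ℝ} {s : Set ℝ} (hs : IsOpen s) {c : ℝ}
    (h : ∀ t ∈ s, η t = c) (a : ℝ) {t : ℝ} (ht : t ∈ s) : a * η t + t * deriv η t = a * c := by
  have : η =ᶠ[𝓝 t] fun _ => c := by
    filter_upwards [hs.mem_nhds ht] with s hs using h s hs
  simp [h t ht, this.deriv_eq]

theorem mul_integral_laplaceIntegrand {a : ℝ} {η : ℝ → ℝ} (hη : ContDiff ℝ ∞ η)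
    (h0 : (∃ δ > 0, ∀ t < δ, η t = 0) ∨ 0 < a)
    (hR : ∃ R c : ℝ, ∀ t > R, η t = c) {z : ℂ} (hz : 0 < z.re) :
    z * ∫ t in Set.Ioi 0, laplaceIntegrand a η z t =
      ∫ t in Set.Ioi 0, laplaceIntegrand (a - 1) (fun t => a * η t + t * deriv η t) z t := by
  have hηc := hη.continuous
  have hη1 : Continuous (fun t => a * η t + t * deriv η t) := by
    have := hη.continuous_deriv (by simp)
    fun_prop
  have hi : IntegrableOn (laplaceIntegrand a η z) (Set.Ioi 0) :=
    integrableOn_laplaceIntegrand hηc (h0.imp id (fun h => by linarith)) hR hz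
  have hi1 : IntegrableOn
      (laplaceIntegrand (a - 1) (fun t => a * η t + t * deriv η t) z) (Set.Ioi 0) := by
    refine integrableOn_laplaceIntegrand hη1 ?_ ?_ hz
    · refine h0.imp ?_ (fun h => by linarith)
      rintro ⟨δ, hδ, h⟩
      exact ⟨δ, hδ, fun t ht => by simpa using euler_step_eq_of_isOpen isOpen_Iio h a ht⟩
    · obtain ⟨R, c, h⟩ := hR
      exact ⟨R, a * c, fun t ht => euler_step_eq_of_isOpen isOpen_Ioi h a ht⟩
  have hzero : laplaceIntegrand a η z 0 = 0 := by
    rcases h0 with ⟨δ, hδ, h⟩ | h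
    · simp [laplaceIntegrand, h 0 hδ]
    · simp [laplaceIntegrand, Real.zero_rpow h.ne']
  have hcont : ContinuousWithinAt (laplaceIntegrand a η z) (Set.Ici 0) 0 := by
    apply ContinuousAt.continuousWithinAt
    rcases h0 with ⟨δ, hδ, h⟩ | h
    · have : laplaceIntegrand a η z =ᶠ[𝓝 0] fun _ => 0 := by
        filter_upwards [Iio_mem_nhds hδ] with s hs
        simp [laplaceIntegrand, h s hs]
      exact continuousAt_const.congr this.symm
    · unfold laplaceIntegrand
      refine ContinuousAt.mul (Complex.continuous_ofReal.continuousAt.comp ?_) (by fun_prop)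
      exact (continuousAt_rpow_const 0 a (Or.inr h.le)).mul hηc.continuousAt
  have htop : Tendsto (laplaceIntegrand a η z) atTop (𝓝 0) := by
    obtain ⟨C, hC⟩ := exists_bound_of_eventually_const hηc hR
    have h1 := (tendsto_rpow_mul_exp_neg_mul_atTop_nhds_zero a z.re hz).const_mul C
    rw [mul_zero] at h1
    refine squeeze_zero_norm' ?_ h1
    filter_upwards [eventually_gt_atTop 0] with t ht
    rw [norm_laplaceIntegrand, abs_mul, abs_of_nonneg (Real.rpow_nonneg ht.le a)]
    have := mul_le_mul_of_nonneg_right (hC t ht)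
      (mul_nonneg (Real.rpow_nonneg ht.le a) (Real.exp_pos (-z.re * t)).le)
    linarith
  have h := integral_Ioi_of_hasDerivAt_of_tendsto hcont
    (fun t ht => hasDerivAt_laplaceIntegrand hη z ht) (hi1.sub (hi.const_mul z)) htop
  rw [hzero, sub_zero, integral_sub hi1 (hi.const_mul z), integral_const_mul] at h
  exact (sub_eq_zero.1 h).symm

/-- Repeated integration by parts: if `t ^ a * η t` has enough room at both ends, its Laplace
transform is `O(‖z‖ ^ (-m))` in the right half-plane. -/
theorem exists_norm_integral_laplaceIntegrand_le (m : ℕ) : ∀ (a : ℝ) (η : ℝ → ℝ),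
    ContDiff ℝ ∞ η → ((∃ δ > 0, ∀ t < δ, η t = 0) ∨ (m : ℝ) - 1 < a) →
    (∃ R c : ℝ, ∀ t > R, η t = c) → ((∃ R : ℝ, ∀ t > R, η t = 0) ∨ a < (m : ℝ) - 1) →
    ∃ C, ∀ z : ℂ, 0 < z.re →
      ‖∫ t in Set.Ioi 0, laplaceIntegrand a η z t‖ ≤ C / ‖z‖ ^ m := by
  induction m with
  | zero =>
    intro a η hη h0 hR h1
    refine ⟨∫ t in Set.Ioi 0, |t ^ a * η t|, fun z hz => ?_⟩
    have hi := integrableOn_Ioi_rpow_mul hη.continuous (by simpa using h0) hR (by simpa using h1)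
    rw [pow_zero, div_one]
    refine norm_integral_le_of_norm_le hi.abs ?_
    filter_upwards [ae_restrict_mem measurableSet_Ioi] with t ht
    rw [norm_laplaceIntegrand]
    refine mul_le_of_le_one_right (abs_nonneg _) (Real.exp_le_one_iff.2 ?_)
    have : 0 < z.re * t := mul_pos hz ht
    linarith
  | succ m ih =>
    intro a η hη h0 hR h1
    push_cast at h0 h1
    have hm : (0 : ℝ) ≤ m := m.cast_nonneg
    obtain ⟨C, hC⟩ := ih (a - 1) (fun t => a * η t + t * deriv η t) (by
        have : ContDiff ℝ ∞ (deriv η) := (contDiff_infty_iff_deriv.1 hη).2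
        fun_prop) (by
        refine h0.imp ?_ (fun h => by linarith)
        rintro ⟨δ, hδ, h⟩
        exact ⟨δ, hδ, fun t ht => by simpa using euler_step_eq_of_isOpen isOpen_Iio h a ht⟩) (by
        obtain ⟨R, c, h⟩ := hR
        exact ⟨R, a * c, fun t ht => euler_step_eq_of_isOpen isOpen_Ioi h a ht⟩) (by
        refine h1.imp ?_ (fun h => by linarith)
        rintro ⟨R, h⟩
        exact ⟨R, fun t ht => by simpa using euler_step_eq_of_isOpen isOpen_Ioi h a ht⟩)
    refine ⟨C, fun z hz => ?_⟩
    have hz0 : 0 < ‖z‖ := norm_pos_iff.2 fun h => by simp [h] at hz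
    have h2 := hC z hz
    rw [← mul_integral_laplaceIntegrand hη (h0.imp id fun h => by linarith) hR hz, norm_mul] at h2
    rw [pow_succ, ← div_div, le_div_iff₀ hz0]
    linarith

theorem hasDerivAt_integral_laplaceIntegrand_one {a : ℝ} (ha : -1 < a) {z : ℂ} (hz : 0 < z.re) :
    HasDerivAt (fun w => ∫ t in Set.Ioi 0, laplaceIntegrand a (fun _ => 1) w t)
      (-∫ t in Set.Ioi 0, laplaceIntegrand (a + 1) (fun _ => 1) z t) z := by
  have hc : ∀ a, ∀ w : ℂ, AEStronglyMeasurable (laplaceIntegrand a (fun _ => 1) w)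
      (volume.restrict (Set.Ioi 0)) := fun a w =>
    (continuousOn_laplaceIntegrand continuous_const w).aestronglyMeasurable measurableSet_Ioi
  have hs : {w : ℂ | z.re / 2 < w.re} ∈ 𝓝 z :=
    (isOpen_lt continuous_const Complex.continuous_re).mem_nhds (by simpa using hz)
  have hR : ∃ R c : ℝ, ∀ t > R, (fun _ : ℝ => (1 : ℝ)) t = c := ⟨0, 1, fun _ _ => rfl⟩
  have hb : IntegrableOn (fun t => ‖laplaceIntegrand (a + 1) (fun _ => 1) ((z.re / 2 : ℝ) : ℂ) t‖)
      (Set.Ioi 0) :=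
    (integrableOn_laplaceIntegrand continuous_const (Or.inr (by linarith)) hR
      (by rw [Complex.ofReal_re]; linarith)).norm
  have h := hasDerivAt_integral_of_dominated_loc_of_deriv_le (μ := volume.restrict (Set.Ioi 0))
    (F := fun w t => laplaceIntegrand a (fun _ => 1) w t) (x₀ := z)
    (F' := fun w t => -laplaceIntegrand (a + 1) (fun _ => 1) w t) hs
    (Eventually.of_forall fun w => hc a w)
    (integrableOn_laplaceIntegrand continuous_const (Or.inr ha) hR hz)
    (hc (a + 1) z).neg
    (bound := fun t => ‖laplaceIntegrand (a + 1) (fun _ => 1) ((z.re / 2 : ℝ) : ℂ) t‖) ?_ hb ?_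
  · rw [← integral_neg]
    exact h.2
  · filter_upwards [ae_restrict_mem measurableSet_Ioi] with t ht w hw
    rw [norm_neg, norm_laplaceIntegrand, norm_laplaceIntegrand, Complex.ofReal_re]
    have : z.re / 2 * t ≤ w.re * t := mul_le_mul_of_nonneg_right (le_of_lt hw) (le_of_lt ht)
    exact mul_le_mul_of_nonneg_left (Real.exp_le_exp.2 (by linarith)) (abs_nonneg _)
  · filter_upwards [ae_restrict_mem measurableSet_Ioi] with t ht w _
    have h1 : HasDerivAt (fun w : ℂ => -w * (t : ℂ)) (-1 * (t : ℂ)) w :=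
      (hasDerivAt_id w).neg.mul_const _
    refine (h1.cexp.const_mul _).congr_deriv ?_
    rw [laplaceIntegrand, Real.rpow_add_one (ne_of_gt ht)]
    push_cast
    ring

/-- The Laplace transform of `t ^ a` in the right half-plane. -/
theorem integral_laplaceIntegrand_one {a : ℝ} (ha : -1 < a) {z : ℂ} (hz : 0 < z.re) :
    ∫ t in Set.Ioi 0, laplaceIntegrand a (fun _ => 1) z t =
      (Real.Gamma (a + 1) : ℂ) * z ^ (-(a + 1) : ℂ) := by
  have hR : ∃ R c : ℝ, ∀ t > R, (fun _ : ℝ => (1 : ℝ)) t = c := ⟨0, 1, fun _ _ => rfl⟩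
  set J : ℂ → ℂ := fun w => w ^ (a + 1 : ℂ) *
    ∫ t in Set.Ioi 0, laplaceIntegrand a (fun _ => 1) w t with hJ
  have hd : ∀ w : ℂ, 0 < w.re → HasDerivAt J 0 w := by
    intro w hw
    have hw0 : w ≠ 0 := fun h => by simp [h] at hw
    have h1 : HasDerivAt (fun w : ℂ => w ^ (a + 1 : ℂ)) _ w :=
      (hasDerivAt_id w).cpow_const (c := (a + 1 : ℂ)) (Or.inl hw)
    refine (h1.mul (hasDerivAt_integral_laplaceIntegrand_one ha hw)).congr_deriv ?_
    have h2 := mul_integral_laplaceIntegrand (a := a + 1) (η := fun _ => 1) contDiff_const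
      (Or.inr (by linarith)) hR hw
    have h3 : (∫ t in Set.Ioi 0, laplaceIntegrand (a + 1 - 1)
        (fun t => (a + 1) * (fun _ : ℝ => (1 : ℝ)) t + t * deriv (fun _ : ℝ => (1 : ℝ)) t) w t) =
        (a + 1) * ∫ t in Set.Ioi 0, laplaceIntegrand a (fun _ => 1) w t := by
      rw [← integral_const_mul]
      congr 1
      ext t
      simp only [laplaceIntegrand, deriv_const, add_sub_cancel_right]
      push_cast
      ring
    rw [h3] at h2
    have h4 : w ^ (a + 1 : ℂ) = w ^ (a + 1 - 1 : ℂ) * w := by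
      rw [Complex.cpow_sub _ _ hw0, Complex.cpow_one]; field_simp
    simp only [id]
    rw [h4]
    linear_combination -w ^ (a + 1 - 1 : ℂ) * h2
  have hconst : J z = J 1 := by
    have ho : IsOpen {w : ℂ | 0 < w.re} := isOpen_lt continuous_const Complex.continuous_re
    have hp : IsPreconnected {w : ℂ | 0 < w.re} := (convex_halfSpace_re_gt 0).isPreconnected
    exact ho.is_const_of_deriv_eq_zero hp
      (fun w hw => (hd w hw).differentiableAt.differentiableWithinAt)
      (fun w hw => (hd w hw).deriv) hz (by simp)
  have h1 : J 1 = (Real.Gamma (a + 1) : ℂ) := by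
    have h := Real.integral_rpow_mul_exp_neg_mul_Ioi (a := a + 1) (by linarith) one_pos
    simp only [hJ, Complex.one_cpow, one_mul]
    rw [show Real.Gamma (a + 1) = ∫ t in Set.Ioi (0 : ℝ), t ^ (a + 1 - 1) * Real.exp (-(1 * t)) by
      rw [h]; simp, ← integral_complex_ofReal]
    congr 1
    ext t
    simp [laplaceIntegrand]
  rw [h1] at hconst
  rw [Complex.cpow_neg, ← hconst, hJ]
  have : z ^ (a + 1 : ℂ) ≠ 0 := by
    rw [Ne, Complex.cpow_eq_zero_iff]
    rintro ⟨h, -⟩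
    simp [h] at hz
  field_simp

/-- Differentiation of `x ↦ ∫₀¹ s ^ k * f (s * x)` under the integral sign. -/
theorem hasDerivAt_integral_pow_mul_comp_mul {f : ℝ → ℝ} (hf : ContDiff ℝ ∞ f) (k : ℕ) (x : ℝ) :
    HasDerivAt (fun x => ∫ s in (0 : ℝ)..1, s ^ k * f (s * x))
      (∫ s in (0 : ℝ)..1, s ^ (k + 1) * deriv f (s * x)) x := by
  have hf' : Continuous (deriv f) := hf.continuous_deriv (by simp)
  have hfc := hf.continuous
  obtain ⟨C, hC⟩ := ((isCompact_Icc (a := (0 : ℝ)) (b := 1)).prod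
    (isCompact_closedBall x 1)).exists_bound_of_continuousOn
    (f := fun p : ℝ × ℝ => p.1 ^ (k + 1) * deriv f (p.1 * p.2)) (by fun_prop)
  refine (intervalIntegral.hasDerivAt_integral_of_dominated_loc_of_deriv_le
    (bound := fun _ => C) (F' := fun x s => s ^ (k + 1) * deriv f (s * x))
    (Metric.closedBall_mem_nhds x one_pos)
    (Eventually.of_forall fun y => Continuous.aestronglyMeasurable (by fun_prop))
    (Continuous.intervalIntegrable (by fun_prop) _ _)
    (Continuous.aestronglyMeasurable (by fun_prop)) ?_
    (Continuous.intervalIntegrable (by fun_prop) _ _) ?_).2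
  · refine Eventually.of_forall fun s hs y hy => ?_
    rw [Set.uIoc_of_le zero_le_one] at hs
    exact hC (s, y) ⟨⟨hs.1.le, hs.2⟩, hy⟩
  · refine Eventually.of_forall fun s _ y _ => ?_
    have h1 : HasDerivAt (fun y => f (s * y)) (deriv f (s * y) * (s * 1)) y :=
      HasDerivAt.comp y ((hf.differentiable (by simp)) (s * y)).hasDerivAt
        ((hasDerivAt_id y).const_mul s)
    refine (h1.const_mul (s ^ k)).congr_deriv ?_
    ring

theorem contDiff_integral_pow_mul_comp_mul {f : ℝ → ℝ} (hf : ContDiff ℝ ∞ f) (k : ℕ) :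
    ContDiff ℝ ∞ (fun x => ∫ s in (0 : ℝ)..1, s ^ k * f (s * x)) := by
  rw [contDiff_infty]
  intro n
  induction n generalizing f k with
  | zero =>
    rw [Nat.cast_zero, contDiff_zero, continuous_iff_continuousAt]
    exact fun x => (hasDerivAt_integral_pow_mul_comp_mul hf k x).continuousAt
  | succ n ih =>
    push_cast
    rw [contDiff_succ_iff_deriv]
    refine ⟨fun x => (hasDerivAt_integral_pow_mul_comp_mul hf k x).differentiableAt, by simp, ?_⟩
    rw [funext fun x => (hasDerivAt_integral_pow_mul_comp_mul hf k x).deriv]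
    exact ih (contDiff_infty_iff_deriv.1 hf).2 (k + 1)

/-- Hadamard's lemma on the line. -/
theorem contDiff_dslope_zero {f : ℝ → ℝ} (hf : ContDiff ℝ ∞ f) : ContDiff ℝ ∞ (dslope f 0) := by
  have hf' : Continuous (deriv f) := hf.continuous_deriv (by simp)
  have : dslope f 0 = fun x => ∫ s in (0 : ℝ)..1, s ^ 0 * deriv f (s * x) := by
    ext x
    rcases eq_or_ne x 0 with rfl | hx
    · simp
    · rw [dslope_of_ne _ hx, slope_def_field]
      simp only [pow_zero, one_mul, sub_zero]
      rw [intervalIntegral.integral_comp_mul_right _ hx, zero_mul, one_mul,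
        intervalIntegral.integral_deriv_eq_sub (fun y _ => (hf.differentiable (by simp)) y)
          (hf'.intervalIntegrable _ _), smul_eq_mul]
      field_simp
  rw [this]
  exact contDiff_integral_pow_mul_comp_mul (contDiff_infty_iff_deriv.1 hf).2 0

theorem exists_taylor_three {f : ℝ → ℝ} (hf : ContDiff ℝ ∞ f) (h0 : deriv f 0 = 0) :
    ∃ (b : ℝ) (Q : ℝ → ℝ), ContDiff ℝ ∞ Q ∧ ∀ t, f t = f 0 + b * t ^ 2 + t ^ 3 * Q t := by
  refine ⟨dslope (dslope f 0) 0 0, dslope (dslope (dslope f 0) 0) 0,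
    contDiff_dslope_zero (contDiff_dslope_zero (contDiff_dslope_zero hf)), fun t => ?_⟩
  have h1 := sub_smul_dslope f 0 t
  have h2 := sub_smul_dslope (dslope f 0) 0 t
  have h3 := sub_smul_dslope (dslope (dslope f 0) 0) 0 t
  rw [dslope_same f, h0] at h2
  simp only [sub_zero, smul_eq_mul] at h1 h2 h3
  linear_combination -h1 - t * h2 - t ^ 2 * h3

/-- Leading asymptotics of the Laplace transform of `t ^ γ * H t` as `‖z‖ → ∞` in the right
half-plane, for `H` smooth with bounded support on the right and `H' 0 = 0`. -/
theorem exists_norm_integral_laplaceIntegrand_sub_le {γ R : ℝ} (hγ : -1 < γ) {H : ℝ → ℝ}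
    (hH : ContDiff ℝ ∞ H) (hR : ∀ t > R, H t = 0) (h0 : deriv H 0 = 0) :
    ∃ C, 0 ≤ C ∧ ∀ z : ℂ, 0 < z.re → 1 ≤ ‖z‖ →
      ‖(∫ t in Set.Ioi 0, laplaceIntegrand γ H z t)
        - H 0 * (Real.Gamma (γ + 1) * z ^ (-(γ + 1) : ℂ))‖ ≤ C * ‖z‖ ^ (-(γ + 3)) := by
  obtain ⟨b, Q, hQ, hT⟩ := exists_taylor_three hH h0
  set M := max R 1
  set η : ℝ → ℝ := fun t => Real.smoothTransition (t - M)
  have hη : ContDiff ℝ ∞ η := Real.smoothTransition.contDiff.comp (contDiff_id.sub contDiff_const)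
  have hη0 : ∀ t ≤ M, η t = 0 := fun t ht =>
    Real.smoothTransition.zero_of_nonpos (by linarith)
  have hη1 : ∀ t > M + 1, η t = 1 := fun t ht =>
    Real.smoothTransition.one_of_one_le (by linarith)
  have hQη : ContDiff ℝ ∞ fun t => Q t * (1 - η t) := hQ.mul (contDiff_const.sub hη)
  have hz : ∃ δ > 0, ∀ t < δ, η t = 0 :=
    ⟨1, one_pos, fun t ht => hη0 t (ht.le.trans (le_max_right R 1))⟩
  have hc : ∃ R c : ℝ, ∀ t > R, η t = c := ⟨M + 1, 1, hη1⟩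
  have hQ0 : ∀ t > M + 1, Q t * (1 - η t) = 0 := fun t ht => by simp [hη1 t ht]
  have hone : ∃ R c : ℝ, ∀ t > R, (fun _ : ℝ => (1 : ℝ)) t = c := ⟨0, 1, fun _ _ => rfl⟩
  set m := ⌈γ + 3⌉₊
  have hm1 : γ + 3 ≤ m := Nat.le_ceil _
  have hm2 : (m : ℝ) < γ + 3 + 1 := Nat.ceil_lt_add_one (by linarith)
  obtain ⟨C₁, hC₁⟩ := exists_norm_integral_laplaceIntegrand_le (m + 1) γ η hη (Or.inl hz) hc
    (Or.inr (by push_cast; linarith))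
  obtain ⟨C₂, hC₂⟩ := exists_norm_integral_laplaceIntegrand_le (m + 1) (γ + 2) η hη (Or.inl hz) hc
    (Or.inr (by push_cast; linarith))
  obtain ⟨C₃, hC₃⟩ := exists_norm_integral_laplaceIntegrand_le m (γ + 3) _ hQη
    (Or.inr (by linarith)) ⟨M + 1, 0, hQ0⟩ (Or.inl ⟨M + 1, hQ0⟩)
  have hpow : ∀ (C : ℝ) (k : ℕ) (r : ℝ), 1 ≤ r → m ≤ k → C / r ^ k ≤ |C| * r ^ (-(γ + 3)) := by
    intro C k r hr hk
    have hr0 : 0 < r := zero_lt_one.trans_le hr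
    have h1 : r ^ (γ + 3) ≤ r ^ k := by
      rw [← Real.rpow_natCast]
      exact Real.rpow_le_rpow_of_exponent_le hr (hm1.trans (by exact_mod_cast hk))
    rw [Real.rpow_neg hr0.le, ← div_eq_mul_inv]
    exact div_le_div₀ (abs_nonneg C) (le_abs_self C) (Real.rpow_pos_of_pos hr0 _) h1
  refine ⟨|H 0| * |C₁| + |b| * (|Real.Gamma (γ + 3)| + |C₂|) + |C₃|, by positivity,
    fun z hz1 hz2 => ?_⟩
  have hi1 := integrableOn_laplaceIntegrand (a := γ) continuous_const (Or.inr hγ) hone hz1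
  have hi2 := integrableOn_laplaceIntegrand (a := γ) hη.continuous (Or.inl hz) hc hz1
  have hi3 := integrableOn_laplaceIntegrand (a := γ + 2) continuous_const
    (Or.inr (by linarith)) hone hz1
  have hi4 := integrableOn_laplaceIntegrand (a := γ + 2) hη.continuous (Or.inl hz) hc hz1
  have hi5 := integrableOn_laplaceIntegrand (a := γ + 3) hQη.continuous
    (Or.inr (by linarith)) ⟨M + 1, 0, hQ0⟩ hz1
  have hsplit : (∫ t in Set.Ioi 0, laplaceIntegrand γ H z t) =
      H 0 * ((∫ t in Set.Ioi 0, laplaceIntegrand γ (fun _ => 1) z t) -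
        ∫ t in Set.Ioi 0, laplaceIntegrand γ η z t) +
      b * ((∫ t in Set.Ioi 0, laplaceIntegrand (γ + 2) (fun _ => 1) z t) -
        ∫ t in Set.Ioi 0, laplaceIntegrand (γ + 2) η z t) +
      ∫ t in Set.Ioi 0, laplaceIntegrand (γ + 3) (fun t => Q t * (1 - η t)) z t := by
    have hi12 : IntegrableOn (fun t => (H 0 : ℂ) *
        (laplaceIntegrand γ (fun _ => 1) z t - laplaceIntegrand γ η z t)) (Set.Ioi 0) :=
      (hi1.sub hi2).const_mul _
    have hi34 : IntegrableOn (fun t => (b : ℂ) *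
        (laplaceIntegrand (γ + 2) (fun _ => 1) z t - laplaceIntegrand (γ + 2) η z t))
        (Set.Ioi 0) := (hi3.sub hi4).const_mul _
    rw [← integral_sub hi1 hi2, ← integral_sub hi3 hi4, ← integral_const_mul,
      ← integral_const_mul, ← integral_add hi12 hi34,
      ← integral_add (Integrable.fun_add hi12 hi34) hi5]
    refine setIntegral_congr_fun measurableSet_Ioi fun t ht => ?_
    have ht0 : t ≠ 0 := ne_of_gt ht
    have e1 : H t = (H 0 + b * t ^ 2 + t ^ 3 * Q t) * (1 - η t) := by
      rcases le_or_gt t M with h | h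
      · rw [hη0 t h, ← hT]; ring
      · have h2 : H t = 0 := hR t ((le_max_left R 1).trans_lt h)
        rw [← hT, h2, zero_mul]
    have e2 : t ^ (γ + 2) = t ^ γ * t ^ 2 := by
      exact_mod_cast Real.rpow_add_natCast ht0 γ 2
    have e3 : t ^ (γ + 3) = t ^ γ * t ^ 3 := by
      exact_mod_cast Real.rpow_add_natCast ht0 γ 3
    simp only [laplaceIntegrand]
    rw [e1, e2, e3]
    push_cast
    ring
  rw [hsplit, integral_laplaceIntegrand_one hγ hz1, integral_laplaceIntegrand_one (by linarith) hz1]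
  have hg : ‖((Real.Gamma (γ + 2 + 1) : ℝ) : ℂ) * z ^ (-((γ + 2 : ℝ) + 1) : ℂ)‖ =
      |Real.Gamma (γ + 3)| * ‖z‖ ^ (-(γ + 3)) := by
    rw [norm_mul, Complex.norm_real, Real.norm_eq_abs,
      show (-((γ + 2 : ℝ) + 1) : ℂ) = ((-(γ + 3) : ℝ) : ℂ) by push_cast; ring,
      Complex.norm_cpow_real, show γ + 2 + 1 = γ + 3 by ring]
  have n1 := (hC₁ z hz1).trans (hpow C₁ (m + 1) _ hz2 (Nat.le_succ m))
  have n2 := (hC₂ z hz1).trans (hpow C₂ (m + 1) _ hz2 (Nat.le_succ m))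
  have n3 := (hC₃ z hz1).trans (hpow C₃ m _ hz2 le_rfl)
  set r := ‖z‖ ^ (-(γ + 3))
  set A := ∫ t in Set.Ioi 0, laplaceIntegrand γ η z t
  set B := ∫ t in Set.Ioi 0, laplaceIntegrand (γ + 2) η z t
  set D := ∫ t in Set.Ioi 0, laplaceIntegrand (γ + 3) (fun t => Q t * (1 - η t)) z t
  set G := ((Real.Gamma (γ + 2 + 1) : ℝ) : ℂ) * z ^ (-((γ + 2 : ℝ) + 1) : ℂ)
  calc _ = ‖-(H 0 * A) + b * (G - B) + D‖ := by congr 1; ring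
    _ ≤ ‖-(H 0 * A)‖ + ‖b * (G - B)‖ + ‖D‖ := norm_add₃_le
    _ ≤ |H 0| * ‖A‖ + |b| * (‖G‖ + ‖B‖) + ‖D‖ := by
      rw [norm_neg, norm_mul, norm_mul, Complex.norm_real, Complex.norm_real, Real.norm_eq_abs,
        Real.norm_eq_abs]
      gcongr
      exact norm_sub_le _ _
    _ ≤ |H 0| * (|C₁| * r) + |b| * (|Real.Gamma (γ + 3)| * r + |C₂| * r) + |C₃| * r := by
      rw [hg]
      gcongr
    _ = _ := by ring

/-- Leading asymptotics of the cosine transform of `t ^ γ * H t` over the half-line, for `H`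
smooth with bounded support on the right and `H' 0 = 0`. -/
theorem exists_abs_integral_rpow_mul_cos_add_le {γ R : ℝ} (hγ : -1 < γ) {H : ℝ → ℝ}
    (hH : ContDiff ℝ ∞ H) (hR : ∀ t > R, H t = 0) (h0 : deriv H 0 = 0) :
    ∃ C, ∀ ν : ℝ, 1 ≤ ν →
      |(∫ t in Set.Ioi 0, t ^ γ * H t * Real.cos (ν * t))
        + H 0 * Real.Gamma (γ + 1) * Real.sin (π * γ / 2) * ν ^ (-(γ + 1))|
        ≤ C * ν ^ (-(γ + 3)) := by
  obtain ⟨C, hC0, hC⟩ := exists_norm_integral_laplaceIntegrand_sub_le hγ hH hR h0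
  refine ⟨C, fun ν hν => ?_⟩
  have hν0 : 0 < ν := zero_lt_one.trans_le hν
  set z₀ : ℂ := ν * -Complex.I with hz₀
  have hz₀re : z₀.re = 0 := by simp [hz₀]
  have hz₀im : z₀.im = -ν := by simp [hz₀]
  have hi : IntegrableOn (fun t => t ^ γ * H t) (Set.Ioi 0) :=
    integrableOn_Ioi_rpow_mul hH.continuous (Or.inr hγ) ⟨R, 0, hR⟩ (Or.inl ⟨R, hR⟩)
  have hz₀n : ‖z₀‖ = ν := by simp [hz₀, abs_of_pos hν0]
  have htend : Tendsto (fun ε : ℝ => (ε : ℂ) + z₀) (𝓝[>] 0) (𝓝 z₀) := by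
    have : Continuous fun ε : ℝ => (ε : ℂ) + z₀ := by fun_prop
    have h := this.tendsto 0
    simp only [Complex.ofReal_zero, zero_add] at h
    exact h.mono_left nhdsWithin_le_nhds
  have hlim1 : Tendsto (fun ε : ℝ => ∫ t in Set.Ioi 0, laplaceIntegrand γ H ((ε : ℂ) + z₀) t)
      (𝓝[>] 0) (𝓝 (∫ t in Set.Ioi 0, laplaceIntegrand γ H z₀ t)) := by
    refine tendsto_integral_filter_of_dominated_convergence (fun t => |t ^ γ * H t|) ?_ ?_
      hi.abs ?_
    · exact Eventually.of_forall fun ε =>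
        (continuousOn_laplaceIntegrand hH.continuous _).aestronglyMeasurable measurableSet_Ioi
    · filter_upwards [self_mem_nhdsWithin] with ε hε
      filter_upwards [ae_restrict_mem measurableSet_Ioi] with t ht
      rw [norm_laplaceIntegrand]
      refine mul_le_of_le_one_right (abs_nonneg _) (Real.exp_le_one_iff.2 ?_)
      have : 0 < ε * t := mul_pos hε ht
      rw [Complex.add_re, Complex.ofReal_re, hz₀re]
      linarith
    · refine Eventually.of_forall fun t => ?_
      have hcont : Continuous fun w : ℂ => laplaceIntegrand γ H w t := by
        unfold laplaceIntegrand; fun_prop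
      exact (hcont.tendsto z₀).comp htend
  have hlim2 : Tendsto (fun ε : ℝ => ((ε : ℂ) + z₀) ^ (-(γ + 1) : ℂ)) (𝓝[>] 0)
      (𝓝 (z₀ ^ (-(γ + 1) : ℂ))) := by
    have hs : z₀ ∈ Complex.slitPlane := Or.inr (by rw [hz₀im]; linarith)
    exact (continuousAt_cpow_const hs).tendsto.comp htend
  have hle : ‖(∫ t in Set.Ioi 0, laplaceIntegrand γ H z₀ t)
        - H 0 * (Real.Gamma (γ + 1) * z₀ ^ (-(γ + 1) : ℂ))‖ ≤ C * ν ^ (-(γ + 3)) := by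
    refine le_of_tendsto (hlim1.sub ((hlim2.const_mul _).const_mul _)).norm ?_
    filter_upwards [self_mem_nhdsWithin] with ε hε
    have hn : ν ≤ ‖(ε : ℂ) + z₀‖ := by
      have h := Complex.abs_im_le_norm ((ε : ℂ) + z₀)
      rwa [Complex.add_im, Complex.ofReal_im, hz₀im, zero_add, abs_neg, abs_of_pos hν0] at h
    refine (hC _ (by rw [Complex.add_re, Complex.ofReal_re, hz₀re, add_zero]; exact hε)
      (hν.trans hn)).trans ?_
    exact mul_le_mul_of_nonneg_left
      (Real.rpow_le_rpow_of_nonpos hν0 hn (by linarith)) hC0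
  refine le_trans (le_of_eq ?_) ((Complex.abs_re_le_norm _).trans hle)
  congr 1
  have hint : IntegrableOn (laplaceIntegrand γ H z₀) (Set.Ioi 0) := by
    refine hi.abs.mono' ((continuousOn_laplaceIntegrand hH.continuous _).aestronglyMeasurable
      measurableSet_Ioi) (Eventually.of_forall fun t => ?_)
    rw [norm_laplaceIntegrand, hz₀re]
    simp
  have hre : (∫ t in Set.Ioi 0, laplaceIntegrand γ H z₀ t).re =
      ∫ t in Set.Ioi 0, t ^ γ * H t * Real.cos (ν * t) := by
    have h : (∫ t in Set.Ioi 0, RCLike.re (laplaceIntegrand γ H z₀ t)) =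
      RCLike.re (∫ t in Set.Ioi 0, laplaceIntegrand γ H z₀ t) := integral_re hint
    rw [← RCLike.re_eq_complex_re, ← h]
    congr 1
    ext t
    rw [RCLike.re_eq_complex_re, laplaceIntegrand, Complex.re_ofReal_mul,
      show -z₀ * (t : ℂ) = ((ν * t : ℝ) : ℂ) * Complex.I by rw [hz₀]; push_cast; ring,
      Complex.exp_ofReal_mul_I_re]
  have hp : (z₀ ^ (-(γ + 1) : ℂ)).re = -(Real.sin (π * γ / 2) * ν ^ (-(γ + 1))) := by
    rw [show (-(γ + 1) : ℂ) = ((-(γ + 1) : ℝ) : ℂ) by push_cast; ring, Complex.cpow_ofReal_re,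
      hz₀n, hz₀, Complex.arg_real_mul _ hν0, Complex.arg_neg_I,
      show -(π / 2) * -(γ + 1) = π * γ / 2 + π / 2 by ring, Real.cos_add_pi_div_two]
    ring
  rw [Complex.sub_re, Complex.re_ofReal_mul, Complex.re_ofReal_mul, hre, hp]
  ring

theorem contDiff_sinc : ContDiff ℝ ∞ Real.sinc := by
  rw [Real.sinc_eq_dslope]
  exact contDiff_dslope_zero Real.contDiff_sin

theorem sinc_ne_zero_of_abs_lt_pi {x : ℝ} (hx : |x| < π) : Real.sinc x ≠ 0 := by
  rcases eq_or_ne x 0 with rfl | h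
  · simp
  · rw [Real.sinc_of_ne_zero h]
    obtain ⟨h1, h2⟩ := abs_lt.1 hx
    refine div_ne_zero (fun h0 => h ?_) h
    exact (Real.sin_eq_zero_iff_of_lt_of_lt h1 h2).1 h0

theorem deriv_eq_zero_of_comp_sub_eq {E : ℝ → ℝ} {c : ℝ} (h : ∀ t, E (2 * c - t) = E t) :
    deriv E c = 0 := by
  have h1 := deriv_comp_const_sub (f := E) (2 * c) c
  rw [funext h, show 2 * c - c = c by ring] at h1
  linarith

theorem contDiff_comp_cos {g : ℝ → ℝ} (hg : ContDiffOn ℝ ∞ g (Set.Icc (-1) 1)) :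
    ContDiff ℝ ∞ fun t => g (Real.cos t) := by
  rw [← contDiffOn_univ]
  exact hg.comp Real.contDiff_cos.contDiffOn fun t _ => Real.cos_mem_Icc t

/-- If `f x = (1 - x) ^ α * G x` with `G` smooth and vanishing to the left of `-1/2`, then
`f (cos t) = t ^ (2 * α) * H t` with `H` smooth and compactly supported. -/
theorem exists_smooth_factor_comp_cos {α : ℝ} {G f : ℝ → ℝ}
    (hG : ContDiffOn ℝ ∞ G (Set.Icc (-1) 1)) (hG0 : ∀ x ≤ -1 / 2, G x = 0)
    (hf : ∀ x ∈ Set.Icc (-1 : ℝ) 1, f x = (1 - x) ^ α * G x) :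
    ∃ H : ℝ → ℝ, ContDiff ℝ ∞ H ∧ (∀ t > 3, H t = 0) ∧ deriv H 0 = 0 ∧
      H 0 = 2 ^ (-α) * G 1 ∧ ∀ t ∈ Set.Ioc 0 π, f (Real.cos t) = t ^ (2 * α) * H t := by
  let χ : ContDiffBump (0 : ℝ) := ⟨5 / 2, 3, by norm_num, by norm_num⟩
  have hχ1 : ∀ t : ℝ, |t| ≤ 5 / 2 → χ t = 1 := fun t ht =>
    χ.one_of_mem_closedBall (by simpa using ht)
  have hχ0 : ∀ t : ℝ, 3 ≤ |t| → χ t = 0 := fun t ht =>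
    χ.zero_of_le_dist (by simpa using ht)
  have hGc := contDiff_comp_cos hG
  set H : ℝ → ℝ := fun t => 2 ^ (-α) * (Real.sinc (t / 2) ^ 2) ^ α * G (Real.cos t) * χ t with hH
  have hπ := Real.pi_gt_three
  have hHsm : ContDiff ℝ ∞ H := by
    rw [contDiff_iff_contDiffAt]
    intro t
    rcases lt_or_ge |t| π with ht | ht
    · have hs : Real.sinc (t / 2) ^ 2 ≠ 0 := pow_ne_zero 2 (sinc_ne_zero_of_abs_lt_pi (by
        rw [abs_div, abs_two]; linarith))
      have h1 : ContDiffAt ℝ ∞ (fun t : ℝ => Real.sinc (t / 2) ^ 2) t :=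
        ((contDiff_sinc.comp (contDiff_id.div_const 2)).pow 2).contDiffAt
      exact ((contDiffAt_const.mul (h1.rpow_const_of_ne hs)).mul hGc.contDiffAt).mul
        χ.contDiffAt
    · have : H =ᶠ[𝓝 t] fun _ => 0 := by
        filter_upwards [(isOpen_lt continuous_const continuous_abs).mem_nhds
          (show 3 < |t| by linarith)] with s hs
        simp [hH, hχ0 s (le_of_lt hs)]
      exact contDiffAt_const.congr_of_eventuallyEq this
  refine ⟨H, hHsm, ?_, ?_, ?_, ?_⟩
  · intro t ht
    simp [hH, hχ0 t (by rw [abs_of_pos (by linarith)]; exact ht.le)]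
  · refine deriv_eq_zero_of_comp_sub_eq fun t => ?_
    have h1 : χ (-t) = χ t := χ.neg t
    simp [hH, neg_div, h1]
  · simp [hH, hχ1 0 (by norm_num)]
  · intro t ht
    rw [hf _ (Real.cos_mem_Icc t)]
    rcases le_or_gt t (5 / 2) with h | h
    · have ht0 : 0 < t := ht.1
      have h1 : 1 - Real.cos t = t ^ 2 * (2⁻¹ * Real.sinc (t / 2) ^ 2) := by
        rw [Real.sinc_of_ne_zero (by positivity)]
        have h2 : Real.cos t = 1 - 2 * Real.sin (t / 2) ^ 2 := by
          have h4 := Real.cos_two_mul (t / 2)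
          rw [mul_div_cancel₀ t two_ne_zero] at h4
          linarith [Real.sin_sq_add_cos_sq (t / 2)]
        rw [h2]
        field_simp
        ring
      have h3 : (t ^ 2 : ℝ) ^ α = t ^ (2 * α) := by
        rw [Real.rpow_mul ht0.le, Real.rpow_two]
      rw [h1, Real.mul_rpow (by positivity) (by positivity),
        Real.mul_rpow (by positivity) (by positivity), h3, Real.inv_rpow zero_le_two,
        ← Real.rpow_neg zero_le_two]
      simp only [hH, hχ1 t (by rwa [abs_of_pos ht0])]
      ring
    · have h1 : Real.cos t ≤ -1 / 2 := by
        have h2 : Real.cos (π - π / 3) = -(1 / 2) := by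
          rw [Real.cos_pi_sub, Real.cos_pi_div_three]
        have h3 : Real.cos t ≤ Real.cos (π - π / 3) :=
          Real.cos_le_cos_of_nonneg_of_le_pi (by linarith) ht.2
            (by linarith [Real.pi_lt_d2])
        linarith
      simp [hH, hG0 _ h1]

theorem intervalIntegrable_comp_cos_mul_cos {α : ℝ} (hα : -1 / 2 < α) {G f : ℝ → ℝ}
    (hG : ContDiffOn ℝ ∞ G (Set.Icc (-1) 1)) (hG0 : ∀ x ≤ -1 / 2, G x = 0)
    (hf : ∀ x ∈ Set.Icc (-1 : ℝ) 1, f x = (1 - x) ^ α * G x) (n : ℕ) :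
    IntervalIntegrable (fun t => f (Real.cos t) * Real.cos (n * t)) volume 0 π := by
  obtain ⟨H, hH, -, -, -, hfH⟩ := exists_smooth_factor_comp_cos hG hG0 hf
  rw [intervalIntegrable_iff_integrableOn_Ioc_of_le Real.pi_pos.le]
  have hHc := hH.continuous
  refine (integrableOn_Ioc_rpow_mul (a := 2 * α) (η := fun t => H t * Real.cos (n * t))
    (by fun_prop) (Or.inr (by linarith))).congr_fun (fun t ht => ?_) measurableSet_Ioc
  simp only [hfH t ht]
  ring

theorem exists_abs_chebCoeff_add_le {α : ℝ} (hα : -1 / 2 < α) {G f : ℝ → ℝ}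
    (hG : ContDiffOn ℝ ∞ G (Set.Icc (-1) 1)) (hG0 : ∀ x ≤ -1 / 2, G x = 0)
    (hf : ∀ x ∈ Set.Icc (-1 : ℝ) 1, f x = (1 - x) ^ α * G x) :
    ∃ C, ∀ n : ℕ, 1 ≤ n →
      |chebCoeff f n + 2 ^ (1 - α) * G 1 * Real.sin (α * π) * Real.Gamma (2 * α + 1) /
        (π * (n : ℝ) ^ (2 * α + 1))| ≤ C * (n : ℝ) ^ (-(2 * α + 3)) := by
  obtain ⟨H, hH, hH3, hHd, hH0, hfH⟩ := exists_smooth_factor_comp_cos hG hG0 hf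
  obtain ⟨C, hC⟩ := exists_abs_integral_rpow_mul_cos_add_le (γ := 2 * α) (by linarith) hH hH3 hHd
  refine ⟨2 / π * C, fun n hn => ?_⟩
  have hn0 : (0 : ℝ) < n := by exact_mod_cast hn
  have hπ := Real.pi_pos
  have hI : ∫ t in (0 : ℝ)..π, f (Real.cos t) * Real.cos (n * t) =
      ∫ t in Set.Ioi 0, t ^ (2 * α) * H t * Real.cos (n * t) := by
    rw [intervalIntegral.integral_of_le hπ.le,
      setIntegral_eq_of_subset_of_forall_sdiff_eq_zero
        (f := fun t => t ^ (2 * α) * H t * Real.cos (n * t)) measurableSet_Ioi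
        (s := Set.Ioc 0 π) Set.Ioc_subset_Ioi_self ?_]
    · refine setIntegral_congr_fun measurableSet_Ioc fun t ht => ?_
      simp only [hfH t ht]
    · intro t ht
      have : π < t := by
        by_contra h
        exact ht.2 ⟨ht.1, not_lt.1 h⟩
      simp [hH3 t (Real.pi_gt_three.trans this)]
  have h := mul_le_mul_of_nonneg_left (hC n (by exact_mod_cast hn)) (by positivity : 0 ≤ 2 / π)
  rw [← abs_of_nonneg (by positivity : 0 ≤ 2 / π), ← abs_mul, abs_of_nonneg (by positivity :
    0 ≤ 2 / π)] at h
  rw [mul_assoc (2 / π) C]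
  refine le_trans (le_of_eq ?_) h
  congr 1
  rw [chebCoeff, hI, hH0, Real.rpow_neg hn0.le, show 1 - α = 1 + -α by ring,
    Real.rpow_add two_pos, Real.rpow_one, show π * (2 * α) / 2 = α * π by ring]
  field_simp

/-- Integrals of smooth functions symmetric about both endpoints against `cos (n * t)` decay
faster than any power of `n`. -/
theorem exists_abs_integral_mul_cos_le (N : ℕ) : ∀ E : ℝ → ℝ, ContDiff ℝ ∞ E →
    (∀ t, E (2 * 0 - t) = E t) → (∀ t, E (2 * π - t) = E t) →
    ∃ C, ∀ n : ℕ, 1 ≤ n →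
      |∫ t in (0 : ℝ)..π, E t * Real.cos (n * t)| ≤ C / ((n : ℝ) ^ 2) ^ N := by
  induction N with
  | zero =>
    intro E hE _ _
    refine ⟨∫ t in (0 : ℝ)..π, |E t|, fun n _ => ?_⟩
    have hEc := hE.continuous
    rw [pow_zero, div_one]
    refine (intervalIntegral.abs_integral_le_integral_abs Real.pi_pos.le).trans ?_
    refine intervalIntegral.integral_mono_on Real.pi_pos.le
      (Continuous.intervalIntegrable (by fun_prop) _ _)
      (Continuous.intervalIntegrable (by fun_prop) _ _) fun t _ => ?_
    rw [abs_mul]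
    exact mul_le_of_le_one_right (abs_nonneg _) (Real.abs_cos_le_one _)
  | succ N ih =>
    intro E hE h0 hπ
    have hE1 : ContDiff ℝ ∞ (deriv E) := (contDiff_infty_iff_deriv.1 hE).2
    have hE2 : ContDiff ℝ ∞ (deriv (deriv E)) := (contDiff_infty_iff_deriv.1 hE1).2
    have hsymm : ∀ c, (∀ t, E (2 * c - t) = E t) →
        ∀ t, deriv (deriv E) (2 * c - t) = deriv (deriv E) t := by
      intro c hc t
      have h1 : deriv E = fun t => -deriv E (2 * c - t) := by
        ext t
        rw [← deriv_comp_const_sub, funext hc]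
      conv_rhs => rw [h1]
      rw [deriv.fun_neg, deriv_comp_const_sub, neg_neg]
    obtain ⟨C, hC⟩ := ih _ hE2 (hsymm 0 h0) (hsymm π hπ)
    refine ⟨C, fun n hn => ?_⟩
    have hn0 : (0 : ℝ) < n := by exact_mod_cast hn
    have hd : ∀ t ∈ Set.uIcc 0 π, HasDerivAt
        (fun t => E t * (Real.sin (n * t) / n) + deriv E t * (Real.cos (n * t) / n ^ 2))
        (E t * Real.cos (n * t) + 1 / (n : ℝ) ^ 2 * (deriv (deriv E) t * Real.cos (n * t))) t := by
      intro t _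
      have h1 : HasDerivAt (fun t : ℝ => (n : ℝ) * t) (n * 1) t :=
        (hasDerivAt_id t).const_mul _
      have h2 := ((hE.differentiable (by simp)) t).hasDerivAt.mul (h1.sin.div_const (n : ℝ))
      have h3 := ((hE1.differentiable (by simp)) t).hasDerivAt.mul
        (h1.cos.div_const ((n : ℝ) ^ 2))
      refine (h2.add h3).congr_deriv ?_
      field_simp
      ring
    have hEc := hE.continuous
    have hE2c := hE2.continuous
    have hi1 : IntervalIntegrable (fun t => E t * Real.cos (n * t)) volume 0 π :=
      Continuous.intervalIntegrable (by fun_prop) _ _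
    have hi2 : IntervalIntegrable
        (fun t => 1 / (n : ℝ) ^ 2 * (deriv (deriv E) t * Real.cos (n * t))) volume 0 π :=
      Continuous.intervalIntegrable (by fun_prop) _ _
    have h := intervalIntegral.integral_eq_sub_of_hasDerivAt hd (hi1.add hi2)
    rw [intervalIntegral.integral_add hi1 hi2, intervalIntegral.integral_const_mul,
      deriv_eq_zero_of_comp_sub_eq h0, deriv_eq_zero_of_comp_sub_eq hπ, Real.sin_nat_mul_pi] at h
    have h4 : ∫ t in (0 : ℝ)..π, E t * Real.cos (n * t) =
        -(1 / (n : ℝ) ^ 2 * ∫ t in (0 : ℝ)..π, deriv (deriv E) t * Real.cos (n * t)) := by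
      simp at h
      simp
      linarith
    rw [h4, abs_neg, abs_mul, abs_of_nonneg (by positivity), pow_succ ((n : ℝ) ^ 2) N, ← div_div,
      one_div, inv_mul_eq_div]
    exact div_le_div_of_nonneg_right (hC n hn) (by positivity)

/-- Chebyshev coefficients of a smooth function decay faster than any power. -/
theorem chebCoeff_isBigO_of_contDiffOn {f : ℝ → ℝ} (hf : ContDiffOn ℝ ∞ f (Set.Icc (-1) 1))
    (s : ℝ) : (fun n : ℕ => chebCoeff f n) =O[atTop] fun n : ℕ => (n : ℝ) ^ (-s) := by
  obtain ⟨N, hN⟩ := exists_nat_ge s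
  obtain ⟨C, hC⟩ := exists_abs_integral_mul_cos_le N (fun t => f (Real.cos t))
    (contDiff_comp_cos hf) (fun t => by simp) (fun t => by rw [Real.cos_two_pi_sub])
  refine Asymptotics.IsBigO.of_bound (2 / π * |C|) ?_
  filter_upwards [eventually_ge_atTop 1] with n hn
  have hn1 : (1 : ℝ) ≤ n := by exact_mod_cast hn
  have hn0 : (0 : ℝ) < n := zero_lt_one.trans_le hn1
  have hπ : 0 ≤ 2 / π := by positivity
  rw [chebCoeff, norm_mul, Real.norm_of_nonneg hπ,
    Real.norm_of_nonneg (Real.rpow_nonneg hn0.le (-s)), Real.norm_eq_abs, mul_assoc]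
  refine mul_le_mul_of_nonneg_left ((hC n hn).trans ?_) hπ
  rw [Real.rpow_neg hn0.le, ← div_eq_mul_inv]
  refine div_le_div₀ (abs_nonneg C) (le_abs_self C) (by positivity) ?_
  rw [← pow_mul, ← Real.rpow_natCast]
  refine Real.rpow_le_rpow_of_exponent_le hn1 ?_
  push_cast
  linarith [N.cast_nonneg (α := ℝ)]

theorem cos_nat_mul_pi_sub_eq (n : ℕ) (t : ℝ) :
    Real.cos (n * (π - t)) = (-1) ^ n * Real.cos (n * t) := by
  rw [mul_sub, Real.cos_nat_mul_pi_sub]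

theorem chebCoeff_comp_neg (h : ℝ → ℝ) (n : ℕ) :
    chebCoeff (fun x => h (-x)) n = (-1) ^ n * chebCoeff h n := by
  have key := intervalIntegral.integral_comp_sub_left (a := 0) (b := π)
    (fun t => h (-Real.cos t) * Real.cos (n * t)) π
  simp only [sub_self, sub_zero, Real.cos_pi_sub, neg_neg, cos_nat_mul_pi_sub_eq] at key
  rw [chebCoeff, chebCoeff, ← key, mul_left_comm,
    ← intervalIntegral.integral_const_mul ((-1 : ℝ) ^ n)]
  congr 2
  ext t
  ring

theorem intervalIntegrable_neg_cos_mul_cos {h : ℝ → ℝ} {n : ℕ}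
    (hi : IntervalIntegrable (fun t => h (Real.cos t) * Real.cos (n * t)) volume 0 π) :
    IntervalIntegrable (fun t => h (-Real.cos t) * Real.cos (n * t)) volume 0 π := by
  have h1 := (hi.comp_sub_left π).symm.const_mul ((-1) ^ n)
  simp only [sub_self, sub_zero, Real.cos_pi_sub, cos_nat_mul_pi_sub_eq] at h1
  refine h1.congr fun t _ => ?_
  have h2 : ((-1 : ℝ) ^ n) * (-1) ^ n = 1 := by rw [← mul_pow]; simp
  linear_combination (h (-Real.cos t) * Real.cos (n * t)) * h2

theorem contDiffOn_one_add_rpow_mul {β : ℝ} {g ρ : ℝ → ℝ}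
    (hg : ContDiffOn ℝ ∞ g (Set.Icc (-1) 1)) (hρ : ContDiff ℝ ∞ ρ)
    (hρ0 : ∀ x ≤ -1 / 2, ρ x = 0) :
    ContDiffOn ℝ ∞ (fun x => (1 + x) ^ β * g x * ρ x) (Set.Icc (-1) 1) := by
  intro x hx
  rcases lt_or_ge x (-1 / 2) with h | h
  · have : (fun x => (1 + x) ^ β * g x * ρ x) =ᶠ[𝓝 x] fun _ => 0 := by
      filter_upwards [Iio_mem_nhds h] with y hy
      simp [hρ0 y (le_of_lt hy)]
    exact (contDiffAt_const.congr_of_eventuallyEq this).contDiffWithinAt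
  · have h1 : ContDiffAt ℝ ∞ (fun x : ℝ => (1 + x) ^ β) x :=
      (contDiffAt_const.add contDiffAt_id).rpow_const_of_ne (by simp only [id]; linarith)
    exact (h1.contDiffWithinAt.mul (hg x hx)).mul hρ.contDiffAt.contDiffWithinAt

/-- The leading term of the Chebyshev coefficients contributed by the endpoint `1`. -/
noncomputable def endpointTerm (α β c : ℝ) (n : ℕ) : ℝ :=
  2 ^ (β - α + 1) * c * Real.sin (α * π) * Real.Gamma (2 * α + 1) / (π * (n : ℝ) ^ (2 * α + 1))

theorem endpoint_contribution {α β : ℝ} (hα : -1 / 2 < α) {f g ρ : ℝ → ℝ}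
    (hg : ContDiffOn ℝ ∞ g (Set.Icc (-1) 1)) (hρ : ContDiff ℝ ∞ ρ)
    (hρ0 : ∀ x ≤ -1 / 2, ρ x = 0) (hρ1 : ρ 1 = 1)
    (hf : ∀ x, f x = (1 - x) ^ α * (1 + x) ^ β * g x * ρ x) :
    (∀ n : ℕ, IntervalIntegrable (fun t => f (Real.cos t) * Real.cos (n * t)) volume 0 π) ∧
    ((fun n : ℕ => chebCoeff f n + endpointTerm α β (g 1) n)
      =O[atTop] fun n : ℕ => (n : ℝ) ^ (-(2 * α + 3))) ∧
    ((∃ k : ℕ, α = k) → ∀ s : ℝ,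
      (fun n : ℕ => chebCoeff f n) =O[atTop] fun n : ℕ => (n : ℝ) ^ (-s)) := by
  have hG := contDiffOn_one_add_rpow_mul (β := β) hg hρ hρ0
  have hG0 : ∀ x ≤ -1 / 2, (fun x => (1 + x) ^ β * g x * ρ x) x = 0 := fun x hx => by
    simp [hρ0 x hx]
  have hf' : ∀ x ∈ Set.Icc (-1 : ℝ) 1,
      f x = (1 - x) ^ α * (fun x => (1 + x) ^ β * g x * ρ x) x := fun x _ => by
    simp only [hf]
    ring
  refine ⟨intervalIntegrable_comp_cos_mul_cos hα hG hG0 hf', ?_, ?_⟩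
  · obtain ⟨C, hC⟩ := exists_abs_chebCoeff_add_le hα hG hG0 hf'
    refine Asymptotics.IsBigO.of_bound C ?_
    filter_upwards [eventually_ge_atTop 1] with n hn
    rw [Real.norm_of_nonneg (Real.rpow_nonneg n.cast_nonneg _), Real.norm_eq_abs]
    convert hC n hn using 3
    rw [endpointTerm, hρ1, show β - α + 1 = (1 - α) + β by ring, Real.rpow_add two_pos,
      one_add_one_eq_two]
    ring
  · rintro ⟨k, rfl⟩ s
    refine chebCoeff_isBigO_of_contDiffOn (ContDiffOn.congr (f := fun x : ℝ => (1 - x) ^ k *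
      ((1 + x) ^ β * g x * ρ x)) ?_ fun x hx => ?_) s
    · exact ((contDiff_const.sub contDiff_id).pow k).contDiffOn.mul hG
    · rw [hf' x hx, Real.rpow_natCast]

/-- The two endpoints contribute independently to the Chebyshev coefficients. -/
theorem exists_endpoint_decomposition {α β : ℝ} (hα : -1 / 2 < α) (hβ : -1 / 2 < β)
    {f g : ℝ → ℝ} (hg : ContDiffOn ℝ ∞ g (Set.Icc (-1) 1))
    (hf : ∀ x, f x = (1 - x) ^ α * (1 + x) ^ β * g x) :
    ∃ u v : ℕ → ℝ, (∀ n, chebCoeff f n = u n + (-1) ^ n * v n) ∧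
      ((fun n => u n + endpointTerm α β (g 1) n)
        =O[atTop] fun n : ℕ => (n : ℝ) ^ (-(2 * α + 3))) ∧
      ((fun n => v n + endpointTerm β α (g (-1)) n)
        =O[atTop] fun n : ℕ => (n : ℝ) ^ (-(2 * β + 3))) ∧
      ((∃ k : ℕ, α = k) → ∀ s : ℝ, u =O[atTop] fun n : ℕ => (n : ℝ) ^ (-s)) ∧
      ((∃ k : ℕ, β = k) → ∀ s : ℝ, v =O[atTop] fun n : ℕ => (n : ℝ) ^ (-s)) := by
  have hρ : ContDiff ℝ ∞ fun x => Real.smoothTransition (x + 1 / 2) :=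
    Real.smoothTransition.contDiff.comp (contDiff_id.add contDiff_const)
  have hgneg : ContDiffOn ℝ ∞ (fun x => g (-x)) (Set.Icc (-1) 1) :=
    hg.comp contDiff_neg.contDiffOn fun x hx => ⟨by linarith [hx.2], by linarith [hx.1]⟩
  obtain ⟨hi1, hu, hur⟩ := endpoint_contribution (β := β) hα hg hρ
    (fun x hx => Real.smoothTransition.zero_of_nonpos (by linarith))
    (Real.smoothTransition.one_of_one_le (by norm_num)) (fun _ => rfl)
  obtain ⟨hi2, hv, hvr⟩ := endpoint_contribution (β := α) hβ hgneg
    (f := fun x => (1 - x) ^ β * (1 + x) ^ α * g (-x) *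
      (1 - Real.smoothTransition (-x + 1 / 2)))
    (contDiff_const.sub (hρ.comp contDiff_neg))
    (fun x hx => by
      simp only [Function.comp]
      rw [Real.smoothTransition.one_of_one_le (by linarith), sub_self])
    (by
      simp only [Function.comp]
      rw [Real.smoothTransition.zero_of_nonpos (by norm_num), sub_zero])
    (fun _ => rfl)
  refine ⟨_, _, fun n => ?_, hu, hv, hur, hvr⟩
  have hsum := intervalIntegral.integral_add (hi1 n)
    (intervalIntegrable_neg_cos_mul_cos (h := fun x => (1 - x) ^ β * (1 + x) ^ α * g (-x) *
      (1 - Real.smoothTransition (-x + 1 / 2))) (hi2 n))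
  rw [← chebCoeff_comp_neg, chebCoeff, chebCoeff, chebCoeff, ← mul_add, ← hsum]
  congr 2
  ext t
  simp only [hf, neg_neg, sub_neg_eq_add, ← sub_eq_add_neg]
  ring

theorem isBigO_rpow_neg_of_le {p q : ℝ} (h : q ≤ p) :
    (fun n : ℕ => (n : ℝ) ^ (-p)) =O[atTop] fun n : ℕ => (n : ℝ) ^ (-q) := by
  refine Asymptotics.IsBigO.of_bound 1 ?_
  filter_upwards [eventually_ge_atTop 1] with n hn
  rw [one_mul, Real.norm_of_nonneg (Real.rpow_nonneg n.cast_nonneg _),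
    Real.norm_of_nonneg (Real.rpow_nonneg n.cast_nonneg _)]
  exact Real.rpow_le_rpow_of_exponent_le (by exact_mod_cast hn) (by linarith)

theorem endpointTerm_isBigO (α β c : ℝ) :
    endpointTerm α β c =O[atTop] fun n : ℕ => (n : ℝ) ^ (-(2 * α + 1)) := by
  have : endpointTerm α β c = fun n : ℕ => (2 ^ (β - α + 1) * c * Real.sin (α * π) *
      Real.Gamma (2 * α + 1) / π) * (n : ℝ) ^ (-(2 * α + 1)) := by
    ext n
    rw [endpointTerm, Real.rpow_neg n.cast_nonneg]
    ring
  rw [this]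
  exact Asymptotics.isBigO_const_mul_self _ _ _

theorem isBigO_neg_one_pow_mul {v : ℕ → ℝ} {w : ℕ → ℝ} (h : v =O[atTop] w) :
    (fun n => (-1) ^ n * v n) =O[atTop] w :=
  (Asymptotics.IsBigO.of_bound 1 (Eventually.of_forall fun n => by simp)).trans h

end Helpers

/-- Leading-order asymptotics of the Chebyshev coefficients of
`f(x) = (1−x)^α (1+x)^β g(x)` with `α, β > −1/2` not both integers and `g` smooth on
`[−1,1]`, in the five cases according to whether `α`, `β` are nonnegative integers and
the ordering of `α`, `β`. -/
theorem chebCoeff_leading_asymptotic (α β : ℝ) (hα : -1/2 < α) (hβ : -1/2 < β)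
    (hint : ¬((∃ i : ℤ, α = (i : ℝ)) ∧ (∃ i : ℤ, β = (i : ℝ))))
    (g : ℝ → ℝ) (hg : ContDiffOn ℝ (⊤ : ℕ∞) g (Set.Icc (-1) 1))
    (f : ℝ → ℝ) (hf : ∀ x, f x = (1 - x) ^ α * (1 + x) ^ β * g x) :
    ((¬(∃ k : ℕ, α = (k : ℝ)) ∧ ¬(∃ k : ℕ, β = (k : ℝ))) →
      ((α > β →
        (fun n : ℕ => chebCoeff f n -
            (-1 : ℝ) ^ (n + 1) * 2 ^ (α - β + 1) * g (-1) * Real.sin (β * π) *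
              Real.Gamma (2 * β + 1) / (π * (n : ℝ) ^ (2 * β + 1)))
          =O[atTop] fun n : ℕ => (n : ℝ) ^ (-min (2 * α + 1) (2 * β + 3))) ∧
       (α = β →
        (fun n : ℕ => chebCoeff f n -
            -(2 * Real.sin (α * π) * Real.Gamma (2 * α + 1) /
                (π * (n : ℝ) ^ (2 * α + 1))) * (g 1 + (-1 : ℝ) ^ n * g (-1)))
          =O[atTop] fun n : ℕ => (n : ℝ) ^ (-(2 * α + 3))) ∧
       (α < β →
        (fun n : ℕ => chebCoeff f n -
            -(2 ^ (β - α + 1) * g 1 * Real.sin (α * π) *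
                Real.Gamma (2 * α + 1) / (π * (n : ℝ) ^ (2 * α + 1))))
          =O[atTop] fun n : ℕ => (n : ℝ) ^ (-min (2 * α + 3) (2 * β + 1))))) ∧
    ((∃ k : ℕ, α = (k : ℝ)) →
      (fun n : ℕ => chebCoeff f n -
          (-1 : ℝ) ^ (n + 1) * 2 ^ (α - β + 1) * g (-1) * Real.sin (β * π) *
            Real.Gamma (2 * β + 1) / (π * (n : ℝ) ^ (2 * β + 1)))
        =O[atTop] fun n : ℕ => (n : ℝ) ^ (-(2 * β + 3))) ∧
    ((∃ k : ℕ, β = (k : ℝ)) →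
      (fun n : ℕ => chebCoeff f n -
          -(2 ^ (β - α + 1) * g 1 * Real.sin (α * π) *
              Real.Gamma (2 * α + 1) / (π * (n : ℝ) ^ (2 * α + 1))))
        =O[atTop] fun n : ℕ => (n : ℝ) ^ (-(2 * α + 3))) := by
  obtain ⟨u, v, huv, hu, hv, hur, hvr⟩ := exists_endpoint_decomposition hα hβ hg hf
  have hE1 := endpointTerm_isBigO α β (g 1)
  have hE2 := endpointTerm_isBigO β α (g (-1))
  have hright : ∀ s, s ≤ 2 * β + 3 → u =O[atTop] (fun n : ℕ => (n : ℝ) ^ (-s)) →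
      (fun n : ℕ => chebCoeff f n -
          (-1 : ℝ) ^ (n + 1) * 2 ^ (α - β + 1) * g (-1) * Real.sin (β * π) *
            Real.Gamma (2 * β + 1) / (π * (n : ℝ) ^ (2 * β + 1)))
        =O[atTop] fun n : ℕ => (n : ℝ) ^ (-s) := by
    intro s hs hus
    refine (hus.add (isBigO_neg_one_pow_mul (hv.trans (isBigO_rpow_neg_of_le hs)))).congr_left
      fun n => ?_
    rw [huv, endpointTerm]
    ring
  have hleft : ∀ s, s ≤ 2 * α + 3 → v =O[atTop] (fun n : ℕ => (n : ℝ) ^ (-s)) →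
      (fun n : ℕ => chebCoeff f n -
          -(2 ^ (β - α + 1) * g 1 * Real.sin (α * π) *
              Real.Gamma (2 * α + 1) / (π * (n : ℝ) ^ (2 * α + 1))))
        =O[atTop] fun n : ℕ => (n : ℝ) ^ (-s) := by
    intro s hs hvs
    refine ((hu.trans (isBigO_rpow_neg_of_le hs)).add (isBigO_neg_one_pow_mul hvs)).congr_left
      fun n => ?_
    rw [huv, endpointTerm]
    ring
  refine ⟨fun _ => ⟨fun _ => ?_, fun h => ?_, fun _ => ?_⟩, fun h => hright _ le_rfl (hur h _),
    fun h => hleft _ le_rfl (hvr h _)⟩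
  · refine hright _ (min_le_right _ _) ?_
    have h := (hu.trans (isBigO_rpow_neg_of_le (q := 2 * α + 1) (by linarith))).sub hE1
    exact (h.congr_left fun n => by ring).trans (isBigO_rpow_neg_of_le (min_le_left _ _))
  · subst h
    refine (hu.add (isBigO_neg_one_pow_mul hv)).congr_left fun n => ?_
    rw [huv, endpointTerm, endpointTerm, sub_self, zero_add, Real.rpow_one]
    ring
  · refine hleft _ (min_le_left _ _) ?_
    have h := (hv.trans (isBigO_rpow_neg_of_le (q := 2 * β + 1) (by linarith))).sub hE2
    exact (h.congr_left fun n => by ring).trans (isBigO_rpow_neg_of_le (min_le_right _ _))
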